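/- arXiv:0809.3539 — 2 statements merged into one kernel-verified Lean document; each statement's English description precedes it below -/
import Mathlib

section
/- For every integer d ≥ 2 there exist constants C₁, C₂, C₃ > 0 such that for every odd prime power q and every E ⊆ F_q^d with no null pairs and |E| ≥ C₁ q^{(d+1)/2}, one has C₂|E|³/q ≤ f(E) ≤ C₃|E|³/q. -/
open Finset

/-- `degE E p r` is the number of points of `E` at distance `r` from `p`, where the
distance in `F_q^d` is `‖p − y‖ = ∑ i, (p i − y i)²`. -/
def degE {F : Type} [Field F] [DecidableEq F] {d : ℕ} (E : Finset (Fin d → F))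
    (p : Fin d → F) (r : F) : ℕ :=
  (E.filter (fun y => ∑ i, (p i - y i) ^ 2 = r)).card

/-- `fE E = ∑_{r ∈ F_q*} ∑_{p ∈ E} deg_E(p,r)²` is the sum of the squared multiplicities
of the nonzero distances determined by `E`. -/
def fE {F : Type} [Field F] [Fintype F] [DecidableEq F] {d : ℕ}
    (E : Finset (Fin d → F)) : ℕ :=
  ∑ r ∈ Finset.univ.filter (fun r : F => r ≠ 0), ∑ p ∈ E, (degE E p r) ^ 2

theorem two_ne_zero_of_odd_card {F : Type*} [Field F] [Fintype F]
    (h : Odd (Fintype.card F)) : (2 : F) ≠ 0 := by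
  refine Ring.two_ne_zero fun hc => ?_
  have h0 := FiniteField.even_card_of_char_two hc
  rw [Nat.odd_iff] at h
  omega

section

variable {F : Type} [Field F] [Fintype F] [DecidableEq F] {d : ℕ}

/-- Perpendicular bisectors of distinct points have at most `q ^ (d - 1)` points. -/
theorem card_bisector_mul_le (h2 : (2 : F) ≠ 0) {y z : Fin d → F} (hyz : y ≠ z) :
    (univ.filter fun p : Fin d → F =>
      ∑ i, (p i - y i) ^ 2 = ∑ i, (p i - z i) ^ 2).card * Fintype.card F
      ≤ Fintype.card F ^ d := by
  obtain ⟨j, hj⟩ := Function.ne_iff.mp hyz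
  have key : ∀ (p : Fin d → F) (t : F),
      ∑ i, (p i - y i) ^ 2 = ∑ i, (p i - z i) ^ 2 →
      ∑ i, (((p + Pi.single j t : Fin d → F) i - y i) ^ 2
        - ((p + Pi.single j t : Fin d → F) i - z i) ^ 2) = 2 * (z j - y j) * t := by
    intro p t hp
    have hterm : ∀ i, ((p + Pi.single j t : Fin d → F) i - y i) ^ 2
        - ((p + Pi.single j t : Fin d → F) i - z i) ^ 2
        = ((p i - y i) ^ 2 - (p i - z i) ^ 2)
          + 2 * (z i - y i) * (Pi.single j t : Fin d → F) i := by
      intro i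
      simp only [Pi.add_apply]
      ring
    rw [Finset.sum_congr rfl fun i _ => hterm i, Finset.sum_add_distrib,
      Finset.sum_sub_distrib, hp, sub_self, zero_add,
      Finset.sum_eq_single j (fun i _ hi => by simp [hi]) (by simp)]
    simp
  rw [← Finset.card_univ (α := F), ← Finset.card_product]
  calc _ ≤ (univ : Finset (Fin d → F)).card := by
        refine Finset.card_le_card_of_injOn (fun a => a.1 + Pi.single j a.2) (by simp) ?_
        rintro ⟨p, t⟩ hp ⟨p', t'⟩ hp' h
        simp only [coe_product, coe_filter, mem_univ, true_and, coe_univ, Set.mem_prod,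
          Set.mem_ofPred_eq, Set.mem_univ, and_true] at hp hp' h
        have e := key p t hp
        rw [h, key p' t' hp'] at e
        have hne : 2 * (z j - y j) ≠ 0 := mul_ne_zero h2 (sub_ne_zero.mpr (Ne.symm hj))
        have ht := mul_left_cancel₀ hne e
        subst ht
        simpa using h
    _ = _ := by simp

theorem sum_degE (E : Finset (Fin d → F)) (p : Fin d → F) :
    ∑ r, degE E p r = E.card :=
  (Finset.card_eq_sum_card_fiberwise fun _ _ => mem_coe.mpr (mem_univ _)).symm

theorem sum_degE_sq (E : Finset (Fin d → F)) (p : Fin d → F) :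
    ∑ r, degE E p r ^ 2 = ∑ y ∈ E, ∑ z ∈ E,
      if ∑ i, (p i - y i) ^ 2 = ∑ i, (p i - z i) ^ 2 then 1 else 0 := by
  simp only [degE, Finset.card_filter, sq (∑ _ ∈ E, _), Finset.sum_mul_sum]
  rw [Finset.sum_comm]
  refine Finset.sum_congr rfl fun y _ => ?_
  rw [Finset.sum_comm]
  refine Finset.sum_congr rfl fun z _ => ?_
  simp [eq_comm]

theorem card_sq_le_card_mul_sum_degE_sq (E : Finset (Fin d → F)) (p : Fin d → F) :
    E.card ^ 2 ≤ Fintype.card F * ∑ r, degE E p r ^ 2 := by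
  rw [← sum_degE E p]
  exact sq_sum_le_card_mul_sum_sq

/-- Counts the triples `(p, y, z)` with `y, z ∈ E` equidistant from an arbitrary point `p`. -/
theorem card_mul_sum_sum_degE_sq_le (h2 : (2 : F) ≠ 0) (E : Finset (Fin d → F)) :
    Fintype.card F * ∑ p, ∑ r, degE E p r ^ 2
      ≤ Fintype.card F ^ (d + 1) * E.card + Fintype.card F ^ d * E.card ^ 2 := by
  have hpair : ∀ y z : Fin d → F,
      Fintype.card F * (univ.filter fun p : Fin d → F =>
        ∑ i, (p i - y i) ^ 2 = ∑ i, (p i - z i) ^ 2).card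
      ≤ (if y = z then Fintype.card F ^ (d + 1) else 0) + Fintype.card F ^ d := by
    intro y z
    split_ifs with h
    · subst h
      simp [pow_succ, mul_comm]
    · rw [mul_comm, zero_add]
      exact card_bisector_mul_le h2 h
  calc Fintype.card F * ∑ p, ∑ r, degE E p r ^ 2
      = ∑ y ∈ E, ∑ z ∈ E, Fintype.card F * (univ.filter fun p : Fin d → F =>
        ∑ i, (p i - y i) ^ 2 = ∑ i, (p i - z i) ^ 2).card := by
        simp only [sum_degE_sq, Finset.card_filter, ← Finset.mul_sum]
        congr 1
        rw [Finset.sum_comm]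
        exact Finset.sum_congr rfl fun y _ => Finset.sum_comm
    _ ≤ ∑ y ∈ E, ∑ z ∈ E,
        ((if y = z then Fintype.card F ^ (d + 1) else 0) + Fintype.card F ^ d) :=
        Finset.sum_le_sum fun y _ => Finset.sum_le_sum fun z _ => hpair y z
    _ = _ := by
        simp only [Finset.sum_add_distrib, Finset.sum_ite_eq, Finset.sum_const, smul_eq_mul]
        rw [Finset.sum_congr rfl fun y hy => if_pos hy, Finset.sum_const, smul_eq_mul]
        ring

theorem fE_le_sum_degE_sq (E : Finset (Fin d → F)) :
    fE E ≤ ∑ p ∈ E, ∑ r, degE E p r ^ 2 := by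
  rw [fE, Finset.sum_comm]
  exact Finset.sum_le_sum fun p _ =>
    Finset.sum_le_sum_of_subset (Finset.filter_subset _ _)

theorem card_mul_fE_le (h2 : (2 : F) ≠ 0) (E : Finset (Fin d → F)) :
    (Fintype.card F : ℝ) * fE E
      ≤ (E.card : ℝ) ^ 3 + (Fintype.card F : ℝ) ^ (d + 1) * E.card := by
  have hf : (fE E : ℝ) ≤ ∑ p ∈ E, ∑ r, (degE E p r : ℝ) ^ 2 := by
    exact_mod_cast fE_le_sum_degE_sq E
  have hall : (Fintype.card F : ℝ) * ∑ p, ∑ r, (degE E p r : ℝ) ^ 2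
      ≤ (Fintype.card F : ℝ) ^ (d + 1) * E.card
        + (Fintype.card F : ℝ) ^ d * (E.card : ℝ) ^ 2 := by
    exact_mod_cast card_mul_sum_sum_degE_sq_le h2 E
  have hmono : ∑ p ∈ E, ((Fintype.card F : ℝ) * ∑ r, (degE E p r : ℝ) ^ 2
        - (E.card : ℝ) ^ 2)
      ≤ ∑ p, ((Fintype.card F : ℝ) * ∑ r, (degE E p r : ℝ) ^ 2 - (E.card : ℝ) ^ 2) := by
    refine Finset.sum_le_sum_of_subset_of_nonneg (Finset.subset_univ E) fun p _ _ => ?_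
    rw [sub_nonneg]
    exact_mod_cast card_sq_le_card_mul_sum_degE_sq E p
  simp only [Finset.sum_sub_distrib, ← Finset.mul_sum, Finset.sum_const, nsmul_eq_mul,
    Finset.card_univ, Fintype.card_fun, Fintype.card_fin, Nat.cast_pow] at hmono
  have := mul_le_mul_of_nonneg_left hf (Nat.cast_nonneg (α := ℝ) (Fintype.card F))
  linarith

theorem sum_degE_ne_zero (E : Finset (Fin d → F))
    (hE : ∀ x ∈ E, ∀ y ∈ E, x ≠ y → ∑ i, (x i - y i) ^ 2 ≠ 0)
    {p : Fin d → F} (hp : p ∈ E) :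
    ∑ r ∈ univ.filter (fun r : F => r ≠ 0), degE E p r + 1 = E.card := by
  have h0 : degE E p 0 = 1 := by
    rw [degE, Finset.card_eq_one]
    refine ⟨p, Finset.ext fun y => ?_⟩
    rw [Finset.mem_filter, Finset.mem_singleton]
    constructor
    · rintro ⟨hy, h⟩
      by_contra hne
      exact hE p hp y hy (Ne.symm hne) h
    · rintro rfl
      simpa using hp
  rw [← sum_degE E p, ← h0, Finset.filter_ne', Finset.sum_erase_add _ _ (mem_univ _)]

theorem card_mul_sq_le_card_mul_fE (E : Finset (Fin d → F))
    (hE : ∀ x ∈ E, ∀ y ∈ E, x ≠ y → ∑ i, (x i - y i) ^ 2 ≠ 0) :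
    (E.card : ℝ) * (E.card - 1) ^ 2 ≤ (Fintype.card F : ℝ) * fE E := by
  have hpt : ∀ p ∈ E, ((E.card : ℝ) - 1) ^ 2 ≤ (Fintype.card F : ℝ) *
      ∑ r ∈ univ.filter (fun r : F => r ≠ 0), (degE E p r : ℝ) ^ 2 := by
    intro p hp
    have hs : ∑ r ∈ univ.filter (fun r : F => r ≠ 0), (degE E p r : ℝ) = E.card - 1 := by
      rw [← sum_degE_ne_zero E hE hp]
      push_cast
      ring
    rw [← hs]
    refine sq_sum_le_card_mul_sum_sq.trans ?_
    gcongr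
    exact Finset.card_le_univ _
  have hsum := Finset.sum_le_sum hpt
  rw [Finset.sum_const, nsmul_eq_mul, ← Finset.mul_sum, Finset.sum_comm] at hsum
  simpa [fE] using hsum

end

/-- For every `d ≥ 2` there are constants `C₁, C₂, C₃ > 0` such that for every finite
field `F_q` of odd order and every `E ⊆ F_q^d` with no null pairs and
`|E| ≥ C₁ q^{(d+1)/2}`, one has `C₂|E|³/q ≤ f(E) ≤ C₃|E|³/q`. -/
theorem fE_large_sets (d : ℕ) (hd : 2 ≤ d) :
    ∃ C₁ C₂ C₃ : ℝ, 0 < C₁ ∧ 0 < C₂ ∧ 0 < C₃ ∧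
      ∀ (F : Type) [Field F] [Fintype F] [DecidableEq F],
        Odd (Fintype.card F) →
        ∀ E : Finset (Fin d → F),
          (∀ x ∈ E, ∀ y ∈ E, x ≠ y → ∑ i, (x i - y i) ^ 2 ≠ 0) →
          C₁ * (Fintype.card F : ℝ) ^ (((d : ℝ) + 1) / 2) ≤ (E.card : ℝ) →
          C₂ * (E.card : ℝ) ^ 3 / (Fintype.card F : ℝ) ≤ (fE E : ℝ) ∧
            (fE E : ℝ) ≤ C₃ * (E.card : ℝ) ^ 3 / (Fintype.card F : ℝ) := by
  refine ⟨2, 1 / 4, 2, by norm_num, by norm_num, by norm_num, ?_⟩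
  intro F _ _ _ hodd E hE hcard
  have hq : (1 : ℝ) ≤ Fintype.card F := by exact_mod_cast Fintype.card_pos
  have hq0 : (0 : ℝ) < Fintype.card F := by linarith
  have hupper := card_mul_fE_le (two_ne_zero_of_odd_card hodd) E
  have hlower := card_mul_sq_le_card_mul_fE E hE
  have hpow : ((Fintype.card F : ℝ) ^ (((d : ℝ) + 1) / 2)) ^ 2
      = (Fintype.card F : ℝ) ^ (d + 1) := by
    rw [← Real.rpow_mul_natCast hq0.le, ← Real.rpow_natCast]
    congr 1
    push_cast
    ring
  have hone : (1 : ℝ) ≤ (Fintype.card F : ℝ) ^ (((d : ℝ) + 1) / 2) :=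
    Real.one_le_rpow hq (by positivity)
  have hN : (2 : ℝ) ≤ E.card := by linarith
  constructor
  · rw [div_le_iff₀ hq0]
    have : (1 / 4 : ℝ) * (E.card : ℝ) ^ 2 ≤ ((E.card : ℝ) - 1) ^ 2 := by nlinarith
    have := mul_le_mul_of_nonneg_left this (Nat.cast_nonneg (α := ℝ) E.card)
    linarith
  · rw [le_div_iff₀ hq0]
    have : (Fintype.card F : ℝ) ^ (d + 1) ≤ (E.card : ℝ) ^ 2 := by
      rw [← hpow]
      gcongr
      linarith
    have := mul_le_mul_of_nonneg_right this (Nat.cast_nonneg (α := ℝ) E.card)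
    linarith
end

section
/- Let q be an odd prime power, d ≥ 2, and let E ⊆ F_q^d be a set with |E| ≥ 2 and no null pairs. Then |Δ(E)| ≥ (1/8) · min{q, |E|/q^{(d−1)/2}}. -/
open Finset

/-- The distance set `Δ(E) = {‖x − y‖ : x, y ∈ E} ⊆ F_q`, where
`‖x − y‖ = ∑ i, (x i − y i)²`. -/
def distSet {F : Type} [Field F] [DecidableEq F] {d : ℕ}
    (E : Finset (Fin d → F)) : Finset F :=
  (E ×ˢ E).image (fun p => ∑ i, (p.1 i - p.2 i) ^ 2)

open Matrix

section Hyperplanes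

variable {F : Type} [Field F] [DecidableEq F] {d : ℕ}

/-- The number of points of `E` on the hyperplane `a ⬝ᵥ x = b`. -/
def hyperplaneCount (E : Finset (Fin d → F)) (a : Fin d → F) (b : F) : ℕ :=
  #{x ∈ E | a ⬝ᵥ x = b}

lemma hyperplaneCount_smul (E : Finset (Fin d → F)) (a : Fin d → F) (b : F) {c : F}
    (hc : c ≠ 0) : hyperplaneCount E (c • a) (c * b) = hyperplaneCount E a b := by
  unfold hyperplaneCount
  congr 1
  ext x
  simp [smul_dotProduct, hc]

variable [Fintype F]

lemma card_dotProduct_eq_zero_mul {w : Fin d → F} (hw : w ≠ 0) :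
    #{a : Fin d → F | a ⬝ᵥ w = 0} * Fintype.card F = Fintype.card F ^ d := by
  obtain ⟨i, hi⟩ := Function.ne_iff.mp hw
  have hfib : ∀ b : F, #{a : Fin d → F | a ⬝ᵥ w = b} = #{a : Fin d → F | a ⬝ᵥ w = 0} := by
    intro b
    have key : (Pi.single i (b / w i) : Fin d → F) ⬝ᵥ w = b := by
      rw [single_dotProduct]
      exact div_mul_cancel₀ b hi
    refine card_bij' (fun a _ => a - Pi.single i (b / w i))
      (fun a _ => a + Pi.single i (b / w i)) ?_ ?_ ?_ ?_
    · intro a ha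
      simp only [mem_filter, mem_univ, true_and] at ha ⊢
      rw [sub_dotProduct, key, ha, sub_self]
    · intro a ha
      simp only [mem_filter, mem_univ, true_and] at ha ⊢
      rw [add_dotProduct, key, ha, zero_add]
    · simp
    · simp
  have h := card_eq_sum_card_fiberwise (s := (univ : Finset (Fin d → F)))
    (t := (univ : Finset F)) (f := fun a => a ⬝ᵥ w) (by simp)
  simp only [hfib, sum_const, card_univ, smul_eq_mul, Fintype.card_fun, Fintype.card_fin] at h
  rw [h, mul_comm]

lemma sum_hyperplaneCount (E : Finset (Fin d → F)) (a : Fin d → F) :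
    ∑ b, hyperplaneCount E a b = #E :=
  (card_eq_sum_card_fiberwise (t := univ) (by simp)).symm

lemma sum_hyperplaneCount_sq (E : Finset (Fin d → F)) (a : Fin d → F) :
    ∑ b, hyperplaneCount E a b ^ 2 = #{p ∈ E ×ˢ E | a ⬝ᵥ (p.1 - p.2) = 0} := by
  rw [card_eq_sum_card_fiberwise (t := univ) (f := fun p => a ⬝ᵥ p.1) (by simp)]
  refine sum_congr rfl fun b _ => ?_
  rw [sq, hyperplaneCount, ← card_product]
  congr 1
  ext ⟨x, y⟩
  simp only [mem_product, mem_filter, dotProduct_sub, sub_eq_zero]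
  grind

lemma sum_sum_hyperplaneCount_sq (E : Finset (Fin d → F)) :
    (∑ a, ∑ b, hyperplaneCount E a b ^ 2) * Fintype.card F
      = #E * Fintype.card F ^ d * Fintype.card F
        + (#E * #E - #E) * Fintype.card F ^ d := by
  simp only [sum_hyperplaneCount_sq]
  have hswap : ∑ a, #{p ∈ E ×ˢ E | a ⬝ᵥ (p.1 - p.2) = 0}
      = ∑ p ∈ E ×ˢ E, #{a : Fin d → F | a ⬝ᵥ (p.1 - p.2) = 0} := by
    simp only [card_filter]
    exact sum_comm
  rw [hswap, ← diag_union_offDiag, sum_union (disjoint_diag_offDiag E), add_mul]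
  congr 1
  · rw [sum_diag]
    simp
  · rw [sum_mul, sum_congr rfl (g := fun _ => Fintype.card F ^ d), sum_const, offDiag_card,
      smul_eq_mul]
    intro p hp
    exact card_dotProduct_eq_zero_mul (sub_ne_zero.mpr (mem_offDiag.mp hp).2.2)

/-- The variance of the number of points of `E` on a hyperplane. -/
lemma sum_hyperplaneCount_sub_sq (E : Finset (Fin d → F)) :
    (∑ a, ∑ b, ((hyperplaneCount E a b : ℝ) - #E / Fintype.card F) ^ 2) * Fintype.card F
      = #E * (Fintype.card F : ℝ) ^ d * (Fintype.card F - 1) := by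
  have hq : (Fintype.card F : ℝ) ≠ 0 := Nat.cast_ne_zero.mpr Fintype.card_ne_zero
  have h2 : (∑ a, ∑ b, (hyperplaneCount E a b : ℝ) ^ 2) * Fintype.card F
      = #E * (Fintype.card F : ℝ) ^ d * Fintype.card F
        + ((#E : ℝ) * #E - #E) * (Fintype.card F : ℝ) ^ d := by
    have := congrArg (Nat.cast : ℕ → ℝ) (sum_sum_hyperplaneCount_sq E)
    rw [Nat.cast_add, Nat.cast_mul _ (_ ^ d), Nat.cast_sub (Nat.le_mul_self _)] at this
    exact_mod_cast this
  have h1 : ∀ a : Fin d → F, ∑ b, (hyperplaneCount E a b : ℝ) = #E := fun a => by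
    exact_mod_cast sum_hyperplaneCount E a
  simp only [sub_sq, sum_add_distrib, sum_sub_distrib, ← sum_mul, ← mul_sum, h1, sum_const,
    card_univ, Fintype.card_fun, Fintype.card_fin, nsmul_eq_mul, Nat.cast_pow]
  rw [add_mul, sub_mul, h2]
  field_simp
  ring

end Hyperplanes

section Bisectors

variable {F : Type} [Field F] {d : ℕ}

/-- Coordinates of the perpendicular bisector of `p.2.1` and `p.2.2`, scaled by `p.1`. -/
def bisector (p : F × (Fin d → F) × (Fin d → F)) : (Fin d → F) × F :=
  (p.1 • (2 : F) • (p.2.1 - p.2.2), p.1 * (p.2.1 ⬝ᵥ p.2.1 - p.2.2 ⬝ᵥ p.2.2))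

lemma sum_sub_sq_eq_dotProduct (x y : Fin d → F) :
    ∑ i, (x i - y i) ^ 2 = (x - y) ⬝ᵥ (x - y) := by
  simp [dotProduct, sq]

/-- A bisector, together with an endpoint, determines the other endpoint and the scaling. -/
lemma bisector_injective (h2 : (2 : F) ≠ 0) {l l' : F} {y z z' : Fin d → F} (hl' : l' ≠ 0)
    (hyz : (y - z) ⬝ᵥ (y - z) ≠ 0) (hl : l ≠ 0)
    (h : bisector (l, y, z) = bisector (l', y, z')) : l = l' ∧ z = z' := by
  obtain ⟨ha, hb⟩ := Prod.mk.inj h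
  dsimp only at ha hb
  obtain ⟨w, rfl⟩ : ∃ w, z = y - w := ⟨y - z, by simp⟩
  obtain ⟨w', rfl⟩ : ∃ w, z' = y - w := ⟨y - z', by simp⟩
  simp only [sub_sub_cancel] at ha hyz
  rw [smul_comm l, smul_comm l'] at ha
  have ha : l • w = l' • w' := smul_right_injective _ h2 ha
  have h1 : l * (y ⬝ᵥ w) = l' * (y ⬝ᵥ w') := by
    simpa [dotProduct_smul] using congrArg (fun v => y ⬝ᵥ v) ha
  have h3 : l ^ 2 * (w ⬝ᵥ w) = l' ^ 2 * (w' ⬝ᵥ w') := by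
    have := congrArg (fun v => v ⬝ᵥ v) ha
    simp only [dotProduct_smul, smul_dotProduct, smul_eq_mul] at this
    linear_combination this
  simp only [sub_dotProduct, dotProduct_sub, dotProduct_comm w y, dotProduct_comm w' y] at hb
  have h4 : l * (w ⬝ᵥ w) = l' * (w' ⬝ᵥ w') := by linear_combination 2 * h1 - hb
  have h5 : l = l' := by
    have : l * (w ⬝ᵥ w) * (l - l') = 0 := by linear_combination h3 - l' * h4
    rcases mul_eq_zero.mp this with h | h
    · exact absurd h (mul_ne_zero hl hyz)
    · exact sub_eq_zero.mp h
  subst h5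
  exact ⟨rfl, by rw [smul_right_injective _ hl ha]⟩

variable [DecidableEq F]

lemma hyperplaneCount_bisector (E : Finset (Fin d → F)) {l : F} (hl : l ≠ 0)
    (y z : Fin d → F) :
    hyperplaneCount E (bisector (l, y, z)).1 (bisector (l, y, z)).2
      = #{x ∈ E | ∑ i, (x i - y i) ^ 2 = ∑ i, (x i - z i) ^ 2} := by
  rw [bisector, hyperplaneCount_smul _ _ _ hl, hyperplaneCount]
  congr 1
  ext x
  simp only [mem_filter, sum_sub_sq_eq_dotProduct, smul_dotProduct, sub_dotProduct, dotProduct_sub,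
    smul_eq_mul, dotProduct_comm y x, dotProduct_comm z x]
  refine and_congr_right fun _ => ⟨fun h => ?_, fun h => ?_⟩ <;> linear_combination -h

/-- Cauchy–Schwarz: few distances force many isosceles triangles. -/
lemma card_pow_four_le_distSet_mul (E : Finset (Fin d → F)) :
    #E ^ 4 ≤ #E * #(distSet E) *
      ∑ p ∈ E ×ˢ E, #{x ∈ E | ∑ i, (x i - p.1 i) ^ 2 = ∑ i, (x i - p.2 i) ^ 2} := by
  let ν : (Fin d → F) → F → ℕ := fun x t => #{y ∈ E | ∑ i, (x i - y i) ^ 2 = t}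
  have hν : ∀ x ∈ E, ∑ t ∈ distSet E, ν x t = #E := fun x hx =>
    (card_eq_sum_card_fiberwise fun y hy =>
      mem_image.mpr ⟨(x, y), mem_product.mpr ⟨hx, hy⟩, rfl⟩).symm
  have hν2 : ∀ x ∈ E, ∑ t ∈ distSet E, ν x t ^ 2
      = #{p ∈ E ×ˢ E | ∑ i, (x i - p.1 i) ^ 2 = ∑ i, (x i - p.2 i) ^ 2} := by
    intro x hx
    rw [card_eq_sum_card_fiberwise (t := distSet E) (f := fun p => ∑ i, (x i - p.1 i) ^ 2)]
    · refine sum_congr rfl fun t _ => ?_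
      rw [sq, ← card_product]
      congr 1
      ext ⟨y, z⟩
      simp only [mem_product, mem_filter]
      grind
    · intro p hp
      simp only [coe_filter, Set.mem_ofPred_eq, mem_product] at hp
      exact mem_image.mpr ⟨(x, p.1), mem_product.mpr ⟨hx, hp.1.1⟩, rfl⟩
  have hswap : ∑ p ∈ E ×ˢ E, #{x ∈ E | ∑ i, (x i - p.1 i) ^ 2 = ∑ i, (x i - p.2 i) ^ 2}
      = ∑ x ∈ E, ∑ t ∈ distSet E, ν x t ^ 2 := by
    rw [sum_congr rfl hν2]
    simp only [card_filter]
    exact sum_comm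
  have hcs := sq_sum_le_card_mul_sum_sq (s := E ×ˢ distSet E) (f := fun p => ν p.1 p.2)
  rw [sum_product, sum_product, sum_congr rfl hν, sum_const, smul_eq_mul, card_product] at hcs
  rw [hswap]
  calc #E ^ 4 = (#E * #E) ^ 2 := by ring
    _ ≤ _ := hcs

variable [Fintype F]

/-- A set without null pairs has few non-degenerate isosceles triangles, counted by base. -/
lemma sum_offDiag_isosceles_le (h2 : (2 : F) ≠ 0) (E : Finset (Fin d → F))
    (hnull : ∀ x ∈ E, ∀ y ∈ E, x ≠ y → ∑ i, (x i - y i) ^ 2 ≠ 0) :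
    (∑ p ∈ E.offDiag,
        ((#{x ∈ E | ∑ i, (x i - p.1 i) ^ 2 = ∑ i, (x i - p.2 i) ^ 2} : ℝ)
          - #E / Fintype.card F)) ^ 2 * Fintype.card F
      ≤ (#E : ℝ) ^ 4 * (Fintype.card F : ℝ) ^ d := by
  set q : ℝ := (Fintype.card F : ℝ) with hq
  set n : ℝ := (#E : ℝ) with hn
  set S := ∑ p ∈ E.offDiag,
    ((#{x ∈ E | ∑ i, (x i - p.1 i) ^ 2 = ∑ i, (x i - p.2 i) ^ 2} : ℝ) - n / q) with hS
  let P : Finset (F × (Fin d → F) × (Fin d → F)) := (univ.erase 0) ×ˢ E.offDiag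
  let f : (Fin d → F) × F → ℝ := fun h => (hyperplaneCount E h.1 h.2 : ℝ) - n / q
  let m : (Fin d → F) × F → ℝ := fun h => #{p ∈ P | bisector p = h}
  have hq1 : 1 < q := Nat.one_lt_cast.mpr Fintype.one_lt_card
  have hcard : (#(univ.erase (0 : F)) : ℝ) = q - 1 := by
    rw [card_erase_of_mem (mem_univ _), card_univ, Nat.cast_pred Fintype.card_pos]
  have hsum : ∑ h, m h * f h = (q - 1) * S := by
    have : ∑ h, m h * f h = ∑ p ∈ P, f (bisector p) := by
      rw [← sum_fiberwise P bisector]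
      refine sum_congr rfl fun h _ => ?_
      rw [sum_congr rfl (g := fun _ => f h), sum_const, nsmul_eq_mul]
      intro p hp
      rw [(mem_filter.mp hp).2]
    rw [this, sum_product, sum_congr rfl (g := fun _ => S), sum_const, nsmul_eq_mul, hcard]
    intro l hl
    refine sum_congr rfl fun p _ => ?_
    simp only [f]
    rw [hyperplaneCount_bisector E (ne_of_mem_erase hl)]
  have hm : ∀ h, m h ≤ n := by
    intro h
    refine Nat.cast_le.mpr (card_le_card_of_injOn (fun p => p.2.1) ?_ ?_)
    · rintro ⟨l, y, z⟩ hp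
      simp only [P, coe_filter, Set.mem_ofPred_eq, mem_product, mem_offDiag] at hp
      exact hp.1.2.1
    · rintro ⟨l, y, z⟩ hp ⟨l', y', z'⟩ hp' hy
      simp only [P, coe_filter, Set.mem_ofPred_eq, mem_product, mem_offDiag, mem_erase] at hp hp' hy
      subst hy
      have hyz := hnull y hp.1.2.1 z hp.1.2.2.1 hp.1.2.2.2
      rw [sum_sub_sq_eq_dotProduct] at hyz
      obtain ⟨rfl, rfl⟩ :=
        bisector_injective h2 hp'.1.1.1 hyz hp.1.1.1 (hp.2.trans hp'.2.symm)
      rfl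
  have hmsum : ∑ h, m h ≤ (q - 1) * n ^ 2 := by
    have h1 : ∑ h, m h = #P := by
      simp only [m]
      exact_mod_cast (card_eq_sum_card_fiberwise (s := P) (t := univ) (f := bisector)
        (by simp)).symm
    have h3 : (#E.offDiag : ℝ) ≤ n ^ 2 := by
      rw [offDiag_card, hn, sq]
      exact_mod_cast Nat.sub_le _ _
    rw [h1, card_product, Nat.cast_mul, hcard]
    exact mul_le_mul_of_nonneg_left h3 (by linarith)
  have hmsq : ∑ h, m h ^ 2 ≤ n * ((q - 1) * n ^ 2) := by
    calc ∑ h, m h ^ 2 ≤ ∑ h, n * m h := sum_le_sum fun h _ => by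
          rw [sq]; exact mul_le_mul_of_nonneg_right (hm h) (Nat.cast_nonneg _)
      _ = n * ∑ h, m h := (mul_sum ..).symm
      _ ≤ _ := mul_le_mul_of_nonneg_left hmsum (Nat.cast_nonneg _)
  have hf : (∑ h, f h ^ 2) * q = n * q ^ d * (q - 1) := by
    rw [Fintype.sum_prod_type]
    exact sum_hyperplaneCount_sub_sq E
  have hcs := sum_mul_sq_le_sq_mul_sq univ m f
  rw [hsum] at hcs
  have hfin : (q - 1) ^ 2 * (S ^ 2 * q) ≤ (q - 1) ^ 2 * (n ^ 4 * q ^ d) := by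
    calc (q - 1) ^ 2 * (S ^ 2 * q) = ((q - 1) * S) ^ 2 * q := by ring
      _ ≤ ((∑ h, m h ^ 2) * ∑ h, f h ^ 2) * q := mul_le_mul_of_nonneg_right hcs (by linarith)
      _ = (∑ h, m h ^ 2) * ((∑ h, f h ^ 2) * q) := by ring
      _ ≤ (n * ((q - 1) * n ^ 2)) * ((∑ h, f h ^ 2) * q) :=
          mul_le_mul_of_nonneg_right hmsq
            (mul_nonneg (sum_nonneg fun _ _ => sq_nonneg _) (by linarith))
      _ = (q - 1) ^ 2 * (n ^ 4 * q ^ d) := by rw [hf]; ring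
  exact le_of_mul_le_mul_left hfin (by have : 0 < q - 1 := by linarith
                                       positivity)

end Bisectors

/-- If `E ⊆ F_q^d` has `|E| ≥ 2` and no null pairs, then
`|Δ(E)| ≥ (1/8) · min{q, |E|/q^{(d−1)/2}}`. -/
theorem distSet_lower_bound (F : Type) [Field F] [Fintype F] [DecidableEq F]
    (hq : Odd (Fintype.card F)) (d : ℕ) (hd : 2 ≤ d)
    (E : Finset (Fin d → F)) (hE : 2 ≤ E.card)
    (hnull : ∀ x ∈ E, ∀ y ∈ E, x ≠ y → ∑ i, (x i - y i) ^ 2 ≠ 0) :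
    ((distSet E).card : ℝ) ≥
      (1 / 8) * min ((Fintype.card F : ℝ))
        ((E.card : ℝ) / (Fintype.card F : ℝ) ^ (((d : ℝ) - 1) / 2)) := by
  set q : ℝ := (Fintype.card F : ℝ) with hqdef
  set n : ℝ := (#E : ℝ) with hn
  set D : ℝ := (#(distSet E) : ℝ) with hD
  set Q : ℝ := q ^ (((d : ℝ) - 1) / 2) with hQ
  have h2 : (2 : F) ≠ 0 := Ring.two_ne_zero fun h => by
    have := FiniteField.even_card_of_char_two h
    rw [Nat.odd_iff] at hq
    omega
  have hq1 : 1 < q := Nat.one_lt_cast.mpr Fintype.one_lt_card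
  have hn2 : 2 ≤ n := Nat.ofNat_le_cast.mpr hE
  have hd' : (2 : ℝ) ≤ d := by exact_mod_cast hd
  have hQ1 : 1 ≤ Q := Real.one_le_rpow hq1.le (by linarith)
  have hQ2 : Q ^ 2 * q = q ^ d := by
    rw [hQ, ← Real.rpow_natCast, ← Real.rpow_mul (by linarith), ← Real.rpow_add_one (by linarith),
      ← Real.rpow_natCast]
    congr 1
    push_cast
    ring
  have hiso := sum_offDiag_isosceles_le h2 E hnull
  rw [sum_sub_distrib, sum_const, nsmul_eq_mul] at hiso
  set T := ∑ p ∈ E.offDiag,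
    (#{x ∈ E | ∑ i, (x i - p.1 i) ^ 2 = ∑ i, (x i - p.2 i) ^ 2} : ℝ) with hT
  have hTle : T ≤ n ^ 3 / q + n ^ 2 * Q := by
    have h1 : (T - #E.offDiag * (n / q)) ^ 2 ≤ (n ^ 2 * Q) ^ 2 := by
      refine le_of_mul_le_mul_right (hiso.trans_eq ?_) (by linarith : 0 < q)
      rw [← hqdef, ← hn, ← hQ2]
      ring
    have h3 := abs_le_of_sq_le_sq' h1 (by positivity)
    have h4 : (#E.offDiag : ℝ) * (n / q) ≤ n ^ 2 * (n / q) := by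
      refine mul_le_mul_of_nonneg_right ?_ (by positivity)
      rw [offDiag_card, hn, sq]
      exact_mod_cast Nat.sub_le _ _
    have h5 : n ^ 2 * (n / q) = n ^ 3 / q := by ring
    linarith [h3.2]
  have hcs : n ^ 4 ≤ n * D * (n ^ 2 + T) := by
    have h := card_pow_four_le_distSet_mul E
    rw [← diag_union_offDiag, sum_union (disjoint_diag_offDiag E), sum_diag] at h
    simp only [filter_true, sum_const, smul_eq_mul] at h
    rw [hn, hD, hT, sq]
    exact_mod_cast h
  have hD0 : 0 ≤ D := Nat.cast_nonneg _
  set m := min q (n / Q) with hm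
  have hm0 : 0 < m := lt_min (by linarith) (by positivity)
  have hnq : n / q ≤ n / m := div_le_div_of_nonneg_left (by linarith) hm0 (min_le_left _ _)
  have hQm : Q ≤ n / m := by
    rw [le_div_iff₀ hm0, mul_comm]
    exact (le_div_iff₀ (by linarith)).mp (min_le_right _ _)
  have hkey : n ^ 4 ≤ n ^ 4 * (3 * D / m) := by
    calc n ^ 4 ≤ n * D * (n ^ 2 + T) := hcs
      _ ≤ n * D * (n ^ 2 * (3 * (n / m))) := by
          refine mul_le_mul_of_nonneg_left ?_ (by positivity)
          have h6 : n ^ 3 / q = n ^ 2 * (n / q) := by ring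
          nlinarith [sq_nonneg n]
      _ = n ^ 4 * (3 * D / m) := by ring
  have h7 : 1 ≤ 3 * D / m :=
    le_of_mul_le_mul_left (by simpa using hkey) (by positivity : 0 < n ^ 4)
  rw [le_div_iff₀ hm0] at h7
  linarith
end
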